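/- For R = k[X_0, …, X_d] with char k = p > 0, the Hilbert–Kunz density function is given by: HKd(ℙ^d)(x) = x^d/d! for 0 ≤ x < 1; HKd(ℙ^d)(x) = x^d/d! − (1/d!)·Σ_{j=1}^{i} (−1)^{j+1} C(d+1, j)(x−j)^d for i ≤ x < i+1 with 1 ≤ i ≤ d; and HKd(ℙ^d)(x) = 0 for x ≥ d+1. Moreover ∫_ℝ HKd(ℙ^d)(x) dx = 1. -/

import Mathlib

open Filter Topology MeasureTheory

/-- `ℓ(R/m^{[q]})_m`: the `k`-dimension of the degree-`m` graded piece of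
`k[X_0, …, X_d]/(X_0^q, …, X_d^q)`. -/
noncomputable def gradedColengthPd (k : Type*) [Field k] (d q m : ℕ) : ℕ :=
  Module.finrank k
    ((MvPolynomial.homogeneousSubmodule (Fin (d + 1)) k m).map
      (Ideal.Quotient.mkₐ k (Ideal.span
        (Set.range fun i : Fin (d + 1) =>
          (MvPolynomial.X i : MvPolynomial (Fin (d + 1)) k) ^ q))).toLinearMap)

open Finset in
/-- The exponents of the monomials of degree `m` in `d + 1` variables that are not divisible by
any `X_i ^ q`. -/
noncomputable def boundedExponents (d q m : ℕ) : Finset (Fin (d + 1) →₀ ℕ) :=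
  {e ∈ finsuppAntidiag univ m | ∀ i, e i < q}

lemma mem_boundedExponents {d q m : ℕ} {e : Fin (d + 1) →₀ ℕ} :
    e ∈ boundedExponents d q m ↔ ∑ i, e i = m ∧ ∀ i, e i < q := by
  simp [boundedExponents]

/-- The ideal generated by the `q`-th powers of the variables is a monomial ideal. -/
lemma mem_span_range_X_pow_iff {k : Type*} [Field k] {d q : ℕ}
    {f : MvPolynomial (Fin (d + 1)) k} :
    f ∈ Ideal.span (Set.range fun i : Fin (d + 1) =>
      (MvPolynomial.X i : MvPolynomial (Fin (d + 1)) k) ^ q) ↔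
      ∀ e ∈ f.support, ∃ i, q ≤ e i := by
  have h : (Set.range fun i : Fin (d + 1) =>
      (MvPolynomial.X i : MvPolynomial (Fin (d + 1)) k) ^ q) =
      (fun s => MvPolynomial.monomial s (1 : k)) ''
        Set.range fun i : Fin (d + 1) => Finsupp.single i q := by
    rw [← Set.range_comp]
    simp [Function.comp_def, MvPolynomial.X_pow_eq_monomial]
  rw [h, MvPolynomial.mem_ideal_span_monomial_image]
  simp [Finsupp.single_le_iff]

lemma gradedColengthPd_eq_card (k : Type*) [Field k] (d q m : ℕ) :
    gradedColengthPd k d q m = (boundedExponents d q m).card := by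
  classical
  set I := Ideal.span (Set.range fun i : Fin (d + 1) =>
    (MvPolynomial.X i : MvPolynomial (Fin (d + 1)) k) ^ q) with hI
  let π := (Ideal.Quotient.mkₐ k I).toLinearMap
  have hπ : ∀ f, π f = 0 ↔ ∀ e ∈ f.support, ∃ i, q ≤ e i := fun f => by
    rw [← mem_span_range_X_pow_iff, ← hI]
    exact Ideal.Quotient.eq_zero_iff_mem
  let v : boundedExponents d q m → MvPolynomial (Fin (d + 1)) k ⧸ I :=
    fun e => π (MvPolynomial.monomial e.1 1)
  have hv : LinearIndependent k v := by
    rw [Fintype.linearIndependent_iff]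
    intro g hg e
    have h : π (∑ e, g e • MvPolynomial.monomial e.1 1) = 0 := by
      simpa [v, map_sum, map_smul] using hg
    rw [hπ] at h
    by_contra hne
    obtain ⟨i, hi⟩ := h e.1 (by
      rw [MvPolynomial.mem_support_iff, MvPolynomial.coeff_sum]
      simpa [MvPolynomial.coeff_smul, MvPolynomial.coeff_monomial, Subtype.coe_inj] using hne)
    exact absurd ((mem_boundedExponents.1 e.2).2 i) (not_lt.2 hi)
  have hspan : (MvPolynomial.homogeneousSubmodule (Fin (d + 1)) k m).map π =
      Submodule.span k (Set.range v) := by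
    apply le_antisymm
    · rintro _ ⟨f, hf, rfl⟩
      rw [f.as_sum, map_sum]
      refine Submodule.sum_mem _ fun e he => ?_
      by_cases hq : ∀ i, e i < q
      · have hdeg : ∑ i, e i = m := by
          have := hf (MvPolynomial.mem_support_iff.1 he)
          rwa [← Finsupp.degree_eq_sum, Finsupp.degree_eq_weight_one]
        have hsmul : MvPolynomial.monomial e (f.coeff e) =
            f.coeff e • MvPolynomial.monomial e (1 : k) := by
          simp [MvPolynomial.smul_monomial]
        rw [hsmul, map_smul]
        exact Submodule.smul_mem _ _ (Submodule.subset_span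
          ⟨⟨e, mem_boundedExponents.2 ⟨hdeg, hq⟩⟩, rfl⟩)
      · push Not at hq
        have h0 : π (MvPolynomial.monomial e (f.coeff e)) = 0 := by
          rw [hπ]
          intro e' he'
          rwa [Finset.mem_singleton.1 (MvPolynomial.support_monomial_subset he')]
        rw [h0]
        exact Submodule.zero_mem _
    · rw [Submodule.span_le]
      rintro _ ⟨e, rfl⟩
      refine ⟨_, MvPolynomial.isHomogeneous_monomial 1 ?_, rfl⟩
      rw [Finsupp.degree_eq_sum]
      exact (mem_boundedExponents.1 e.2).1
  change Module.finrank k ((MvPolynomial.homogeneousSubmodule (Fin (d + 1)) k m).map π) = _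
  rw [hspan, finrank_span_eq_card hv, Fintype.card_coe]

open PowerSeries in
/-- Inclusion-exclusion count of the lattice points of `[0, q - 1]^(d + 1)` with coordinate
sum `m`. -/
lemma card_boundedExponents (d q m : ℕ) :
    ((boundedExponents d q m).card : ℤ) = ∑ j ∈ Finset.range (d + 2),
      (-1) ^ j * ((d + 1).choose j : ℤ) *
        if j * q ≤ m then ((d + (m - j * q)).choose d : ℤ) else 0 := by
  classical
  let G : ℤ⟦X⟧ := ∑ a ∈ Finset.range q, X ^ a
  have hG : G = (1 - X ^ q) * mk 1 := by
    have h : G * (1 - X) = 1 - X ^ q := geom_sum_mul_neg X q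
    rw [← h, mul_assoc, mul_comm (1 - X), mk_one_mul_one_sub_eq_one, mul_one]
  have hcount : coeff m (∏ _i : Fin (d + 1), G) = ((boundedExponents d q m).card : ℤ) := by
    rw [coeff_prod, boundedExponents, Finset.card_filter, Nat.cast_sum]
    refine Finset.sum_congr rfl fun e _ => ?_
    simp [G, coeff_X_pow, Finset.prod_ite_zero]
  rw [← hcount, Finset.prod_const, Finset.card_univ, Fintype.card_fin, hG, mul_pow,
    mk_one_pow_eq_mk_choose_add, sub_eq_neg_add, add_pow, Finset.sum_mul, map_sum]
  refine Finset.sum_congr rfl fun j _ => ?_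
  have h : (-(X : ℤ⟦X⟧) ^ q) ^ j * 1 ^ (d + 1 - j) * ((d + 1).choose j : ℤ⟦X⟧) *
      mk (fun n => ((d + n).choose d : ℤ)) =
      C ((-1) ^ j * ((d + 1).choose j : ℤ)) *
        (X ^ (j * q) * mk fun n => ((d + n).choose d : ℤ)) := by
    rw [neg_pow, one_pow, ← pow_mul, mul_comm q j]
    simp
    ring
  rw [h, coeff_C_mul, coeff_X_pow_mul']
  simp

/-- If `r n / q n` tends to `y`, then `C(d + r n, d) / (q n)^d` tends to `y^d / d!`. -/
lemma tendsto_choose_div_pow {q r : ℕ → ℕ} {y : ℝ} (d : ℕ)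
    (hq : Tendsto (fun n => (q n : ℝ)) atTop atTop)
    (hr : Tendsto (fun n => (r n : ℝ) / q n) atTop (𝓝 y)) :
    Tendsto (fun n => ((d + r n).choose d : ℝ) / (q n : ℝ) ^ d) atTop
      (𝓝 (y ^ d / d.factorial)) := by
  have h : ∀ n, ((d + r n).choose d : ℝ) / (q n : ℝ) ^ d =
      (∏ i ∈ Finset.range d, ((r n : ℝ) / q n + (1 + i) / q n)) / d.factorial := fun n => by
    have hasc := Nat.ascFactorial_eq_factorial_mul_choose (r n) d
    rw [Nat.ascFactorial_eq_prod_range, add_comm (r n) d] at hasc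
    have hreal : (∏ i ∈ Finset.range d, ((r n : ℝ) + 1 + i)) =
        d.factorial * ((d + r n).choose d : ℝ) := by exact_mod_cast hasc
    simp_rw [← add_div, ← add_assoc]
    rw [Finset.prod_div_distrib, hreal, Finset.prod_const, Finset.card_range]
    have := Nat.factorial_ne_zero d
    field_simp
  simp_rw [h]
  refine Tendsto.div_const ?_ _
  have hprod := tendsto_finsetProd (Finset.range d) fun i _ =>
    hr.add ((tendsto_const_nhds (x := (1 + i : ℝ))).div_atTop hq)
  simpa using hprod

/-- The degree `N` alternating power sum that computes the total mass. -/
lemma sum_neg_one_pow_mul_choose_mul_pow (N : ℕ) :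
    ∑ j ∈ Finset.range N, (-1 : ℝ) ^ j * (N.choose j) * ((N : ℝ) - j) ^ N =
      N.factorial - (if N = 0 then 1 else 0) := by
  have h := congrFun (fwdDiff_iter_eq_factorial (R := ℝ) (n := N)) 0
  rw [fwdDiff_iter_eq_sum_shift, ← Finset.sum_range_reflect, Finset.sum_range_succ] at h
  simp only [Pi.natCast_apply] at h
  rw [← h, eq_sub_iff_add_eq]
  congr 1
  · refine Finset.sum_congr rfl fun j hj => ?_
    have hj : j ≤ N := (Finset.mem_range.1 hj).le
    simp [Nat.sub_sub_self hj, Nat.choose_symm hj, Nat.cast_sub hj]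
  · rcases eq_or_ne N 0 with rfl | hN <;> simp [*]

/-- The truncated-power form of the Hilbert–Kunz density function of `ℙ^d`. -/
noncomputable def hkDensityPd (d : ℕ) (x : ℝ) : ℝ :=
  ∑ j ∈ Finset.range (d + 1), (-1 : ℝ) ^ j * ((d + 1).choose j) *
    (Set.Ico (j : ℝ) (d + 1)).indicator (fun x => (x - j) ^ d / d.factorial) x

lemma hkDensityPd_of_mem_Ico {d : ℕ} {x : ℝ} (h0 : 0 ≤ x) (hx : x < d + 1) :
    hkDensityPd d x = ∑ j ∈ Finset.range (⌊x⌋₊ + 1),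
      (-1 : ℝ) ^ j * ((d + 1).choose j) * ((x - j) ^ d / d.factorial) := by
  have hfloor : ⌊x⌋₊ < d + 1 := by
    rw [Nat.floor_lt h0]
    exact_mod_cast hx
  symm
  rw [hkDensityPd]
  apply Finset.sum_subset_zero_on_sdiff
  · exact Finset.range_subset_range.2 hfloor
  · intro j hj
    have : ¬ (j : ℝ) ≤ x := by
      rw [← Nat.le_floor_iff h0]
      simp at hj
      omega
    simp [this]
  · intro j hj
    have : (j : ℝ) ≤ x := by
      rw [← Nat.le_floor_iff h0]
      simp at hj
      omega
    simp [this, hx]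

lemma hkDensityPd_of_le {d : ℕ} {x : ℝ} (hx : (d : ℝ) + 1 ≤ x) : hkDensityPd d x = 0 :=
  Finset.sum_eq_zero fun j _ => by simp [not_lt.2 hx]

lemma hkDensityPd_of_neg {d : ℕ} {x : ℝ} (hx : x < 0) : hkDensityPd d x = 0 :=
  Finset.sum_eq_zero fun j _ => by simp [not_le.2 (hx.trans_le (Nat.cast_nonneg j))]

lemma hkDensityPd_eq_ite (d : ℕ) (x : ℝ) :
    hkDensityPd d x =
      if x < 0 then 0
      else if x < (d : ℝ) + 1 then
        x ^ d / (Nat.factorial d) -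
          (1 / (Nat.factorial d)) * ∑ j ∈ Finset.Icc 1 (Nat.floor x),
            (-1 : ℝ) ^ (j + 1) * ((d + 1).choose j) * (x - j) ^ d
      else 0 := by
  split_ifs with h0 hx
  · exact hkDensityPd_of_neg h0
  · rw [hkDensityPd_of_mem_Ico (not_lt.1 h0) hx, Finset.sum_range_eq_add_Ico _ (Nat.succ_pos _),
      ← Finset.Ico_succ_right_eq_Icc, sub_eq_add_neg (x ^ d / _), Finset.mul_sum,
      ← Finset.sum_neg_distrib]
    congr 1
    · simp
    · refine Finset.sum_congr rfl fun j _ => ?_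
      ring
  · exact hkDensityPd_of_le (not_lt.1 hx)

lemma integral_hkDensityPd (d : ℕ) : ∫ x, hkDensityPd d x = 1 := by
  have hint : ∀ j : ℕ, Integrable
      ((Set.Ico (j : ℝ) (d + 1)).indicator fun x => (x - j) ^ d / d.factorial) := fun j => by
    rw [integrable_indicator_iff measurableSet_Ico]
    have hc : Continuous fun x : ℝ => (x - j) ^ d / d.factorial := by fun_prop
    exact (hc.integrableOn_Icc (a := (j : ℝ)) (b := d + 1)).mono_set Set.Ico_subset_Icc_self
  have hval : ∀ j ∈ Finset.range (d + 1),
      ∫ x, (Set.Ico (j : ℝ) (d + 1)).indicator (fun x => (x - j) ^ d / d.factorial) x =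
        (((d + 1 : ℕ) : ℝ) - j) ^ (d + 1) / (d + 1).factorial := fun j hj => by
    have hj : (j : ℝ) ≤ d + 1 := by exact_mod_cast (Finset.mem_range.1 hj).le
    rw [integral_indicator measurableSet_Ico, integral_Ico_eq_integral_Ioc,
      ← intervalIntegral.integral_of_le hj, intervalIntegral.integral_div,
      intervalIntegral.integral_comp_sub_right (fun x => x ^ d), integral_pow, Nat.factorial_succ]
    simp [div_div, mul_comm]
  simp only [hkDensityPd]
  rw [integral_finsetSum _ fun j _ => (hint j).const_mul _]
  simp_rw [integral_const_mul]
  rw [Finset.sum_congr rfl fun j hj => by rw [hval j hj]]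
  simp_rw [← mul_div_assoc]
  rw [← Finset.sum_div, sum_neg_one_pow_mul_choose_mul_pow]
  have := Nat.factorial_ne_zero (d + 1)
  simp [this]

lemma tendsto_gradedColengthPd (k : Type*) [Field k] (d : ℕ) {q : ℕ → ℕ}
    (hqpos : ∀ n, 0 < q n) (hq : Tendsto (fun n => (q n : ℝ)) atTop atTop) {x : ℝ}
    (h0 : 0 ≤ x) :
    Tendsto (fun n => (gradedColengthPd k d (q n) ⌊x * q n⌋₊ : ℝ) / (q n : ℝ) ^ d) atTop
      (𝓝 (hkDensityPd d x)) := by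
  have hmul_le : ∀ n j : ℕ, j * q n ≤ ⌊x * q n⌋₊ ↔ j ≤ ⌊x⌋₊ := fun n j => by
    have : (0 : ℝ) < q n := by exact_mod_cast hqpos n
    rw [Nat.le_floor_iff (by positivity), Nat.le_floor_iff h0, Nat.cast_mul,
      mul_le_mul_iff_left₀ this]
  rcases le_or_gt ((d : ℝ) + 1) x with hx | hx
  · rw [hkDensityPd_of_le hx]
    refine tendsto_const_nhds.congr fun n => ?_
    have hempty : boundedExponents d (q n) ⌊x * q n⌋₊ = ∅ := by
      refine Finset.eq_empty_of_forall_notMem fun e he => ?_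
      obtain ⟨hsum, hlt⟩ := mem_boundedExponents.1 he
      have hle := (hmul_le n (d + 1)).2 (Nat.le_floor (by exact_mod_cast hx))
      have hsum_lt : ∑ i, e i < ∑ _i : Fin (d + 1), q n :=
        Finset.sum_lt_sum_of_nonempty Finset.univ_nonempty fun i _ => hlt i
      simp only [Finset.sum_const, Finset.card_univ, Fintype.card_fin, smul_eq_mul] at hsum_lt
      omega
    simp [gradedColengthPd_eq_card, hempty]
  · rw [hkDensityPd_of_mem_Ico h0 hx]
    have hfloor : ⌊x⌋₊ < d + 1 := by
      rw [Nat.floor_lt h0]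
      exact_mod_cast hx
    have hformula : ∀ n, (gradedColengthPd k d (q n) ⌊x * q n⌋₊ : ℝ) / (q n : ℝ) ^ d =
        ∑ j ∈ Finset.range (⌊x⌋₊ + 1), (-1 : ℝ) ^ j * ((d + 1).choose j) *
          (((d + (⌊x * q n⌋₊ - j * q n)).choose d : ℝ) / (q n : ℝ) ^ d) := fun n => by
      have hcard := congrArg (Int.cast : ℤ → ℝ) (card_boundedExponents d (q n) ⌊x * q n⌋₊)
      push_cast at hcard
      rw [gradedColengthPd_eq_card, hcard, Finset.sum_div]
      simp_rw [hmul_le]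
      symm
      apply Finset.sum_subset_zero_on_sdiff
      · exact Finset.range_subset_range.2 (by omega)
      · intro j hj
        have : ¬ j ≤ ⌊x⌋₊ := by
          simp at hj
          omega
        simp [this]
      · intro j hj
        have : j ≤ ⌊x⌋₊ := Nat.lt_succ_iff.1 (Finset.mem_range.1 hj)
        simp [this, mul_div_assoc]
    simp_rw [hformula]
    refine tendsto_finsetSum _ fun j hj => (tendsto_choose_div_pow d hq ?_).const_mul _
    have hj : j ≤ ⌊x⌋₊ := Nat.lt_succ_iff.1 (Finset.mem_range.1 hj)
    refine (((tendsto_nat_floor_mul_div_atTop h0).comp hq).sub_const (j : ℝ)).congr fun n => ?_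
    have : (q n : ℝ) ≠ 0 := by exact_mod_cast (hqpos n).ne'
    rw [Nat.cast_sub ((hmul_le n j).2 hj), Nat.cast_mul, sub_div, mul_div_cancel_right₀ _ this]
    rfl

/-- The Hilbert–Kunz density function of `ℙ^d`:
`HKd(ℙ^d)(x) = x^d/d!` for `0 ≤ x < 1`,
`HKd(ℙ^d)(x) = x^d/d! − (1/d!)·Σ_{j=1}^{⌊x⌋} (−1)^{j+1} C(d+1,j)(x−j)^d` for `1 ≤ x < d+1`,
and `HKd(ℙ^d)(x) = 0` for `x ≥ d+1`; moreover its integral over `ℝ` equals `1`. -/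
theorem stmt11 (k : Type*) [Field k] (p : ℕ) (hp : p.Prime) [CharP k p] (d : ℕ)
    (φ : ℝ → ℝ)
    (hφ : ∀ x : ℝ, φ x =
      if x < 0 then 0
      else if x < (d : ℝ) + 1 then
        x ^ d / (Nat.factorial d) -
          (1 / (Nat.factorial d)) * ∑ j ∈ Finset.Icc 1 (Nat.floor x),
            (-1 : ℝ) ^ (j + 1) * ((d + 1).choose j) * (x - j) ^ d
      else 0) :
    (∀ x : ℝ, 0 ≤ x → Tendsto
        (fun n : ℕ =>
          (gradedColengthPd k d (p ^ n) (Nat.floor (x * (p : ℝ) ^ n)) : ℝ) / (p : ℝ) ^ (n * d))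
        atTop (nhds (φ x))) ∧
      ∫ x : ℝ, φ x = 1 := by
  obtain rfl : φ = hkDensityPd d := funext fun x => (hφ x).trans (hkDensityPd_eq_ite d x).symm
  refine ⟨fun x hx => ?_, integral_hkDensityPd d⟩
  have hq : Tendsto (fun n => ((p ^ n : ℕ) : ℝ)) atTop atTop :=
    tendsto_natCast_atTop_atTop.comp (tendsto_pow_atTop_atTop_of_one_lt hp.one_lt)
  simpa [pow_mul] using tendsto_gradedColengthPd k d (fun n => pow_pos hp.pos n) hq hx
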